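/- Let ε_n, ρ_n ∈ (0,1) be sequences with ε_n·n/log n → ∞ as n → ∞. Then there exist a constant K, an index n₀, and for each n an ε_n-node differentially private algorithm A_n mapping graphs on n vertices to probability measures on ℝ, such that for every n ≥ n₀ and every p ∈ [0, ρ_n], E_{G ∼ G_{n,p}, x ∼ A_n(G)}[(x − p)²] ≤ K·( ρ_n/n² + max{ρ_n, (log n)/n}·(log n)/(n³·ε_n²) ). -/

import Mathlib

open MeasureTheory ProbabilityTheory

noncomputable section

instance {n : ℕ} : MeasurableSpace (SimpleGraph (Fin n)) := ⊤

/-- The number of edges of a simple graph on `n` vertices. -/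
def edgeCount {n : ℕ} (G : SimpleGraph (Fin n)) : ℕ := G.edgeSet.ncard

/-- `G'` is obtained from `G` by rewiring a single vertex. -/
def Rewire {n : ℕ} (G G' : SimpleGraph (Fin n)) : Prop :=
  ∃ v : Fin n, ∀ a b : Fin n, a ≠ v → b ≠ v → (G.Adj a b ↔ G'.Adj a b)

/-- The node (rewiring) distance between two graphs on `n` vertices. -/
def nodeDist {n : ℕ} (G G' : SimpleGraph (Fin n)) : ℕ :=
  sInf {m : ℕ | ∃ f : ℕ → SimpleGraph (Fin n),
    f 0 = G ∧ f m = G' ∧ ∀ i < m, Rewire (f i) (f (i + 1))}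

/-- The Erdős–Rényi measure `G_{n,p}`. -/
def erMeasure (n : ℕ) (p : ℝ) : Measure (SimpleGraph (Fin n)) :=
  ∑ G : SimpleGraph (Fin n),
    (ENNReal.ofReal (p ^ edgeCount G * (1 - p) ^ (n.choose 2 - edgeCount G))) • Measure.dirac G


open Classical in
/-- All unordered pairs of distinct vertices. -/
def pairsF (n : ℕ) : Finset (Sym2 (Fin n)) := Finset.univ.filter (fun e => ¬ e.IsDiag)

open Classical in
/-- Pairs touching the vertex set `T`. -/
def touchF {n : ℕ} (T : Finset (Fin n)) : Finset (Sym2 (Fin n)) :=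
  (pairsF n).filter (fun e => ∃ v ∈ T, v ∈ e)

open Classical in
/-- The edges of `G` as a finset. -/
def edgesF {n : ℕ} (G : SimpleGraph (Fin n)) : Finset (Sym2 (Fin n)) :=
  (pairsF n).filter (fun e => e ∈ G.edgeSet)

open Classical in
/-- Number of edges of `G` touching `T`. -/
def tauF {n : ℕ} (G : SimpleGraph (Fin n)) (T : Finset (Fin n)) : ℕ :=
  (touchF T ∩ edgesF G).card

lemma mem_edgesF {n : ℕ} (G : SimpleGraph (Fin n)) (e : Sym2 (Fin n)) :
    e ∈ edgesF G ↔ e ∈ G.edgeSet := by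
  simp only [edgesF, pairsF, Finset.mem_filter, Finset.mem_univ, true_and, and_iff_right_iff_imp]
  exact fun h => G.not_isDiag_of_mem_edgeSet h

lemma edgeCount_eq {n : ℕ} (G : SimpleGraph (Fin n)) : edgeCount G = (edgesF G).card := by
  unfold edgeCount
  rw [← Set.ncard_coe_finset]
  congr 1
  ext e
  simp [mem_edgesF]

lemma card_pairsF (n : ℕ) : (pairsF n).card = n.choose 2 := by
  classical
  have h := Sym2.card_subtype_not_diag (α := Fin n)
  rw [Fintype.card_fin, Fintype.card_subtype] at h
  rw [← h, pairsF]

lemma edgesF_subset {n : ℕ} (G : SimpleGraph (Fin n)) : edgesF G ⊆ pairsF n := by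
  classical
  exact Finset.filter_subset _ _

lemma touchF_subset {n : ℕ} (T : Finset (Fin n)) : touchF T ⊆ pairsF n := by
  classical
  exact Finset.filter_subset _ _

lemma edgeCount_le {n : ℕ} (G : SimpleGraph (Fin n)) : edgeCount G ≤ n.choose 2 := by
  rw [edgeCount_eq, ← card_pairsF]
  exact Finset.card_le_card (edgesF_subset G)

lemma touchF_univ (n : ℕ) : touchF (Finset.univ : Finset (Fin n)) = pairsF n := by
  ext e
  simp only [touchF, Finset.mem_filter, Finset.mem_univ, true_and, and_iff_left_iff_imp]
  intro _
  induction e with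
  | _ a b => exact ⟨a, by simp⟩

lemma tauF_univ {n : ℕ} (G : SimpleGraph (Fin n)) : tauF G Finset.univ = edgeCount G := by
  classical
  rw [tauF, touchF_univ, edgeCount_eq]
  congr 1
  convert Finset.inter_eq_right.2 (edgesF_subset G)

lemma card_touchF_le {n : ℕ} (T : Finset (Fin n)) : (touchF T).card ≤ T.card * n := by
  classical
  have h : touchF T ⊆ (T ×ˢ (Finset.univ : Finset (Fin n))).image (fun x => s(x.1, x.2)) := by
    intro e he
    simp only [touchF, Finset.mem_filter] at he
    obtain ⟨_, v, hv, hve⟩ := he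
    obtain ⟨w, rfl⟩ := Sym2.mem_iff_exists.1 hve
    exact Finset.mem_image.2 ⟨(v, w), by simp [hv], rfl⟩
  calc (touchF T).card ≤ _ := Finset.card_le_card h
    _ ≤ (T ×ˢ (Finset.univ : Finset (Fin n))).card := Finset.card_image_le
    _ = _ := by simp

/-- `G` and `H` agree outside `T`. -/
def AgreeOff {n : ℕ} (G H : SimpleGraph (Fin n)) (T : Finset (Fin n)) : Prop :=
  ∀ a b, a ∉ T → b ∉ T → (G.Adj a b ↔ H.Adj a b)

lemma agree_diff {n : ℕ} {G H : SimpleGraph (Fin n)} {T : Finset (Fin n)} (h : AgreeOff G H T) :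
    (edgeCount G : ℝ) - tauF G T = edgeCount H - tauF H T := by
  classical
  have key : edgesF G \ touchF T = edgesF H \ touchF T := by
    ext e
    simp only [Finset.mem_sdiff, and_congr_left_iff, mem_edgesF]
    intro he
    simp only [touchF, pairsF, Finset.mem_filter, Finset.mem_univ, true_and, not_and, not_exists] at he
    by_cases hd : e.IsDiag
    · exact iff_of_false (fun h => G.not_isDiag_of_mem_edgeSet h hd)
        (fun h => H.not_isDiag_of_mem_edgeSet h hd)
    · have := he hd
      induction e with
      | _ a b =>
        simp only [SimpleGraph.mem_edgeSet]
        exact h a b (fun ha => this a ha (by simp)) (fun ha => this b ha (by simp))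
  have h1 : ∀ G : SimpleGraph (Fin n),
      ((edgesF G \ touchF T).card : ℝ) = edgeCount G - tauF G T := by
    intro G
    rw [edgeCount_eq, tauF, eq_sub_iff_add_eq]
    have := Finset.card_sdiff_add_card_inter (edgesF G) (touchF T)
    rw [Finset.inter_comm] at this
    convert (congrArg (Nat.cast (R := ℝ)) this) using 1
    push_cast
    congr!
  rw [← h1, ← h1, key]

/-- Regularity of a graph with tolerance `L`. -/
def Typ {n : ℕ} (L : ℝ) (G : SimpleGraph (Fin n)) : Prop :=
  ∀ T : Finset (Fin n),
    |(tauF G T : ℝ) - (edgeCount G : ℝ) / (n.choose 2 : ℝ) * (touchF T).card| ≤ T.card * L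

lemma edgesF_bot (n : ℕ) : edgesF (⊥ : SimpleGraph (Fin n)) = ∅ := by
  ext e; simp [mem_edgesF]

lemma typ_bot {n : ℕ} {L : ℝ} (hL : 0 ≤ L) : Typ L (⊥ : SimpleGraph (Fin n)) := by
  intro T
  have : 0 ≤ (T.card : ℝ) * L := by positivity
  simpa [tauF, edgeCount_eq, edgesF_bot] using this

/-- Feasible pairs in the definition of the score. -/
abbrev Feas {n : ℕ} (L : ℝ) (G : SimpleGraph (Fin n)) : Type :=
  {x : SimpleGraph (Fin n) × Finset (Fin n) // Typ L x.1 ∧ AgreeOff G x.1 x.2}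

/-- The score of the candidate edge number `k` at the graph `G`. -/
def score {n : ℕ} (L : ℝ) (G : SimpleGraph (Fin n)) (k : ℕ) : ℝ :=
  ⨅ x : Feas L G, ((x.1.2.card : ℝ) + |(edgeCount x.1.1 : ℝ) - k| / L)

lemma feas_nonempty {n : ℕ} {L : ℝ} (hL : 0 ≤ L) (G : SimpleGraph (Fin n)) :
    Nonempty (Feas L G) :=
  ⟨⟨(⊥, Finset.univ), typ_bot hL, fun a _ ha => absurd (Finset.mem_univ a) ha⟩⟩

lemma score_attained {n : ℕ} {L : ℝ} (hL : 0 ≤ L) (G : SimpleGraph (Fin n)) (k : ℕ) :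
    ∃ H : SimpleGraph (Fin n), ∃ T : Finset (Fin n), Typ L H ∧ AgreeOff G H T ∧
      score L G k = (T.card : ℝ) + |(edgeCount H : ℝ) - k| / L := by
  have := feas_nonempty hL G
  obtain ⟨x, hx⟩ := exists_eq_ciInf_of_finite
    (f := fun x : Feas L G => ((x.1.2.card : ℝ) + |(edgeCount x.1.1 : ℝ) - k| / L))
  exact ⟨x.1.1, x.1.2, x.2.1, x.2.2, hx.symm⟩

lemma score_le {n : ℕ} {L : ℝ} {G H : SimpleGraph (Fin n)} {T : Finset (Fin n)} (hH : Typ L H)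
    (h : AgreeOff G H T) (k : ℕ) :
    score L G k ≤ (T.card : ℝ) + |(edgeCount H : ℝ) - k| / L :=
  ciInf_le (f := fun x : Feas L G => ((x.1.2.card : ℝ) + |(edgeCount x.1.1 : ℝ) - k| / L))
    (Set.finite_range _).bddBelow ⟨(H, T), hH, h⟩

lemma score_rewire {n : ℕ} {L : ℝ} (hL : 0 ≤ L) {G G' : SimpleGraph (Fin n)} (h : Rewire G G')
    (k : ℕ) : score L G k ≤ score L G' k + 1 := by
  classical
  obtain ⟨H, T, hH, hT, hs⟩ := score_attained hL G' k
  obtain ⟨v, hv⟩ := h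
  have h1 : AgreeOff G H (insert v T) := by
    intro a b ha hb
    simp only [Finset.mem_insert, not_or] at ha hb
    rw [hv a b ha.1 hb.1]
    exact hT a b ha.2 hb.2
  have h2 := score_le hH h1 k
  have h3 : ((insert v T).card : ℝ) ≤ T.card + 1 := by exact_mod_cast Finset.card_insert_le v T
  linarith

lemma Rewire.symm' {n : ℕ} {G G' : SimpleGraph (Fin n)} (h : Rewire G G') : Rewire G' G := by
  obtain ⟨v, hv⟩ := h
  exact ⟨v, fun a b ha hb => (hv a b ha hb).symm⟩

lemma nodeDist_path {n : ℕ} (G G' : SimpleGraph (Fin n)) :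
    ∃ f : ℕ → SimpleGraph (Fin n), f 0 = G ∧ f (nodeDist G G') = G' ∧
      ∀ i < nodeDist G G', Rewire (f i) (f (i + 1)) := by
  have hne : {m : ℕ | ∃ f : ℕ → SimpleGraph (Fin n),
    f 0 = G ∧ f m = G' ∧ ∀ i < m, Rewire (f i) (f (i + 1))}.Nonempty := by
    refine ⟨n, fun i => 
      { Adj := fun a b => ((a.1 < i ∨ b.1 < i) ∧ G'.Adj a b) ∨ (¬ (a.1 < i ∨ b.1 < i) ∧ G.Adj a b)
        symm := ?_
        loopless := ?_ }, ?_, ?_, ?_⟩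
    · refine ⟨fun a b => ?_⟩
      rw [G.adj_comm, G'.adj_comm, or_comm (a := a.1 < i)]
      exact id
    · exact ⟨fun a => by simp⟩
    · ext a b; simp
    · ext a b; simp
    · intro i hi
      refine ⟨⟨i, hi⟩, fun a b ha hb => ?_⟩
      have ha' : a.1 ≠ i := fun h => ha (Fin.ext h)
      have hb' : b.1 ≠ i := fun h => hb (Fin.ext h)
      have e1 : a.1 < i + 1 ↔ a.1 < i := by omega
      have e2 : b.1 < i + 1 ↔ b.1 < i := by omega
      simp only [e1, e2]
  exact Nat.sInf_mem hne

lemma score_nodeDist {n : ℕ} {L : ℝ} (hL : 0 ≤ L) (G G' : SimpleGraph (Fin n)) (k : ℕ) :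
    |score L G k - score L G' k| ≤ nodeDist G G' := by
  obtain ⟨f, h0, hm, hf⟩ := nodeDist_path G G'
  have key : ∀ i ≤ nodeDist G G', |score L (f 0) k - score L (f i) k| ≤ i := by
    intro i
    induction i with
    | zero => simp
    | succ i ih =>
      intro hi
      have h1 := ih (by omega)
      have h2 := score_rewire hL (hf i (by omega)) k
      have h3 := score_rewire hL (hf i (by omega)).symm' k
      rw [abs_le] at h1 ⊢
      push_cast
      constructor <;> linarith [h1.1, h1.2]
  have := key _ le_rfl
  rwa [h0, hm] at this

/-- Normalising constant. -/
def ZF {n : ℕ} (ε L : ℝ) (M : ℕ) (G : SimpleGraph (Fin n)) : ℝ :=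
  ∑ k ∈ Finset.range (M + 1), Real.exp (-(ε / 2) * score L G k)

lemma ZF_pos {n : ℕ} (ε L : ℝ) (M : ℕ) (G : SimpleGraph (Fin n)) : 0 < ZF ε L M G :=
  Finset.sum_pos (fun _ _ => Real.exp_pos _) ⟨0, by simp⟩

/-- The (finitely supported) exponential mechanism. -/
def mech {n : ℕ} (ε L : ℝ) (M : ℕ) (G : SimpleGraph (Fin n)) : Measure ℝ :=
  ∑ k ∈ Finset.range (M + 1),
    ENNReal.ofReal (Real.exp (-(ε / 2) * score L G k) / ZF ε L M G) •
      Measure.dirac ((k : ℝ) / (n.choose 2 : ℝ))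

lemma mech_prob {n : ℕ} (ε L : ℝ) (M : ℕ) (G : SimpleGraph (Fin n)) :
    IsProbabilityMeasure (mech ε L M G) := by
  constructor
  simp only [mech, Measure.finsetSum_apply, Measure.smul_apply, measure_univ, smul_eq_mul, mul_one]
  rw [← ENNReal.ofReal_sum_of_nonneg (fun _ _ => div_nonneg (Real.exp_pos _).le (ZF_pos _ _ _ _).le),
    ← Finset.sum_div]
  rw [show (∑ k ∈ Finset.range (M + 1), Real.exp (-(ε / 2) * score L G k)) = ZF ε L M G from rfl,
    div_self (ZF_pos _ _ _ _).ne']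
  simp

lemma mech_private {n : ℕ} {ε L : ℝ} (hε : 0 ≤ ε) (hL : 0 ≤ L) (M : ℕ)
    (G G' : SimpleGraph (Fin n)) (S : Set ℝ) :
    mech ε L M G S ≤ ENNReal.ofReal (Real.exp (ε * (nodeDist G G' : ℝ))) * mech ε L M G' S := by
  simp only [mech, Measure.finsetSum_apply, Measure.smul_apply, smul_eq_mul]
  rw [Finset.mul_sum]
  refine Finset.sum_le_sum fun k _ => ?_
  rw [← mul_assoc, ← ENNReal.ofReal_mul (Real.exp_pos _).le]
  gcongr
  set D : ℝ := (nodeDist G G' : ℝ)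
  have hs : ∀ j, Real.exp (-(ε / 2) * score L G j) ≤
      Real.exp (ε / 2 * D) * Real.exp (-(ε / 2) * score L G' j) := by
    intro j
    rw [← Real.exp_add, Real.exp_le_exp]
    have := (abs_le.1 (score_nodeDist hL G G' j)).1
    nlinarith
  have hs' : ∀ j, Real.exp (-(ε / 2) * score L G' j) ≤
      Real.exp (ε / 2 * D) * Real.exp (-(ε / 2) * score L G j) := by
    intro j
    rw [← Real.exp_add, Real.exp_le_exp]
    have := (abs_le.1 (score_nodeDist hL G G' j)).2
    nlinarith
  have hZ : ZF ε L M G' ≤ Real.exp (ε / 2 * D) * ZF ε L M G := by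
    rw [ZF, ZF, Finset.mul_sum]
    exact Finset.sum_le_sum fun j _ => hs' j
  have e1 : Real.exp (ε * D) = Real.exp (ε / 2 * D) * Real.exp (ε / 2 * D) := by
    rw [← Real.exp_add]; congr 1; ring
  rw [e1, ← mul_div_assoc, div_le_div_iff₀ (ZF_pos _ _ _ _) (ZF_pos _ _ _ _)]
  calc _ ≤ (Real.exp (ε / 2 * D) * Real.exp (-(ε / 2) * score L G' k)) *
        (Real.exp (ε / 2 * D) * ZF ε L M G) :=
        mul_le_mul (hs k) hZ (ZF_pos _ _ _ _).le (by positivity)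
    _ = _ := by ring

lemma mech_integral {n : ℕ} (ε L : ℝ) (M : ℕ) (G : SimpleGraph (Fin n)) (f : ℝ → ℝ) :
    ∫ x, f x ∂(mech ε L M G) =
      (∑ k ∈ Finset.range (M + 1), Real.exp (-(ε / 2) * score L G k) *
        f ((k : ℝ) / (n.choose 2 : ℝ))) / ZF ε L M G := by
  unfold mech
  rw [integral_finsetSum_measure, Finset.sum_div]
  · refine Finset.sum_congr rfl fun k _ => ?_
    rw [integral_smul_measure, integral_dirac, ENNReal.toReal_ofReal, smul_eq_mul]
    · ring
    · exact div_nonneg (Real.exp_pos _).le (ZF_pos _ _ _ _).le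
  · intro k _
    exact (integrable_dirac (by simp)).smul_measure ENNReal.ofReal_ne_top

/-- Weight of a graph under the Erdős–Rényi law. -/
def wF {n : ℕ} (p : ℝ) (G : SimpleGraph (Fin n)) : ℝ :=
  p ^ edgeCount G * (1 - p) ^ (n.choose 2 - edgeCount G)

lemma wF_nonneg {n : ℕ} {p : ℝ} (h0 : 0 ≤ p) (h1 : p ≤ 1) (G : SimpleGraph (Fin n)) :
    0 ≤ wF p G := by
  have : 0 ≤ 1 - p := by linarith
  unfold wF; positivity

lemma er_integral {n : ℕ} {p : ℝ} (h0 : 0 ≤ p) (h1 : p ≤ 1) (f : SimpleGraph (Fin n) → ℝ) :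
    ∫ G, f G ∂(erMeasure n p) = ∑ G : SimpleGraph (Fin n), wF p G * f G := by
  unfold erMeasure
  rw [integral_finsetSum_measure]
  · refine Finset.sum_congr rfl fun G _ => ?_
    rw [integral_smul_measure, integral_dirac, smul_eq_mul]
    congr 1
    exact ENNReal.toReal_ofReal (wF_nonneg h0 h1 G)
  · intro k _
    exact (integrable_dirac (by simp)).smul_measure ENNReal.ofReal_ne_top

lemma sum_graphs {n : ℕ} (F : Finset (Sym2 (Fin n)) → ℝ) :
    ∑ G : SimpleGraph (Fin n), F (edgesF G) = ∑ s ∈ (pairsF n).powerset, F s := by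
  classical
  refine Finset.sum_bij' (fun G _ => edgesF G)
    (fun s _ => SimpleGraph.fromEdgeSet (s : Set (Sym2 (Fin n)))) ?_ ?_ ?_ ?_ ?_
  · intro G _
    exact Finset.mem_powerset.2 (edgesF_subset G)
  · intro s _
    exact Finset.mem_univ _
  · intro G _
    have : ((edgesF G : Finset (Sym2 (Fin n))) : Set (Sym2 (Fin n))) = G.edgeSet := by
      ext e; simp [mem_edgesF]
    rw [this, SimpleGraph.fromEdgeSet_edgeSet]
  · intro s hs
    ext e
    rw [mem_edgesF, SimpleGraph.edgeSet_fromEdgeSet]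
    have h1 : e ∈ s → ¬ e.IsDiag := fun h => by
      have := Finset.mem_powerset.1 hs h
      simpa [pairsF] using this
    simp only [Set.mem_sdiff, Finset.mem_coe, and_iff_left_iff_imp]
    simpa using h1
  · intro G _
    rfl

lemma mgf_graph {n : ℕ} (p θ : ℝ) (T : Finset (Fin n)) :
    ∑ G : SimpleGraph (Fin n), wF p G * Real.exp (θ * tauF G T) =
      (p * Real.exp θ + (1 - p)) ^ (touchF T).card := by
  classical
  have h1 := sum_graphs (n := n) (fun s => p ^ s.card * (1 - p) ^ (n.choose 2 - s.card) *
    Real.exp (θ * ((touchF T ∩ s).card : ℝ)))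
  have h2 := Finset.prod_add (fun e => p * (if e ∈ touchF T then Real.exp θ else 1))
    (fun _ => 1 - p) (pairsF n)
  have h3 : ∏ e ∈ pairsF n, (p * (if e ∈ touchF T then Real.exp θ else 1) + (1 - p)) =
      (p * Real.exp θ + (1 - p)) ^ (touchF T).card := by
    have : ∀ e ∈ pairsF n, (p * (if e ∈ touchF T then Real.exp θ else 1) + (1 - p)) =
        if e ∈ touchF T then (p * Real.exp θ + (1 - p)) else 1 := by
      intro e _
      split_ifs <;> ring
    rw [Finset.prod_congr rfl this, Finset.prod_ite_mem,
      Finset.inter_eq_right.2 (touchF_subset T), Finset.prod_const]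
  rw [← h3, h2]
  have h4 : ∀ G : SimpleGraph (Fin n), wF p G * Real.exp (θ * tauF G T) =
      p ^ (edgesF G).card * (1 - p) ^ (n.choose 2 - (edgesF G).card) *
    Real.exp (θ * ((touchF T ∩ edgesF G).card : ℝ)) := by
    intro G
    rw [wF, edgeCount_eq, tauF]
  rw [Finset.sum_congr rfl (fun G _ => h4 G), h1]
  refine Finset.sum_congr rfl fun s hs => ?_
  have hs' := Finset.mem_powerset.1 hs
  rw [Finset.prod_mul_distrib, Finset.prod_const, Finset.prod_const, Finset.prod_ite_mem,
    Finset.prod_const, Finset.card_sdiff_of_subset hs', card_pairsF, ← Real.exp_nat_mul,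
    Finset.inter_comm s]
  rw [mul_comm θ]
  ring

lemma wF_sum (n : ℕ) (p : ℝ) : ∑ G : SimpleGraph (Fin n), wF p G = 1 := by
  have h := mgf_graph (n := n) p 0 ∅
  simpa using h

lemma mgf_bound {n : ℕ} {p θ : ℝ} (h0 : 0 ≤ p) (h1 : p ≤ 1) (hθ : |θ| ≤ 1) (T : Finset (Fin n)) :
    ∑ G : SimpleGraph (Fin n), wF p G * Real.exp (θ * (tauF G T - p * (touchF T).card)) ≤
      Real.exp (p * (touchF T).card * θ ^ 2) := by
  have h2 : ∀ G : SimpleGraph (Fin n), wF p G * Real.exp (θ * (tauF G T - p * (touchF T).card)) =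
      wF p G * Real.exp (θ * tauF G T) * Real.exp (-(θ * p * (touchF T).card)) := by
    intro G
    rw [mul_assoc, ← Real.exp_add]
    congr 2; ring
  rw [Finset.sum_congr rfl (fun G _ => h2 G), ← Finset.sum_mul, mgf_graph]
  have h3 := (abs_le.1 (Real.abs_exp_sub_one_sub_id_le hθ)).2
  have h4 : p * Real.exp θ + (1 - p) ≤ Real.exp (p * θ + p * θ ^ 2) := by
    have := Real.add_one_le_exp (p * θ + p * θ ^ 2)
    nlinarith
  have h5 : 0 ≤ p * Real.exp θ + (1 - p) := by
    have := mul_nonneg h0 (Real.exp_pos θ).le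
    linarith
  calc _ ≤ Real.exp (p * θ + p * θ ^ 2) ^ (touchF T).card * Real.exp (-(θ * p * (touchF T).card)) := by
        gcongr
    _ = _ := by
        rw [← Real.exp_nat_mul, ← Real.exp_add]
        congr 1; ring

lemma sq_le_exp (y : ℝ) : y ^ 2 ≤ Real.exp y + Real.exp (-y) - 2 := by
  have h : (y / 2) ^ 2 ≤ Real.sinh (y / 2) ^ 2 := by
    rcases le_total 0 y with hy | hy
    · have := Real.self_le_sinh_iff.2 (show 0 ≤ y / 2 by linarith)
      exact pow_le_pow_left₀ (by linarith) this 2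
    · have := Real.self_le_sinh_iff.2 (show 0 ≤ -(y / 2) by linarith)
      have h2 := pow_le_pow_left₀ (by linarith) this 2
      rwa [Real.sinh_neg, neg_sq, neg_sq] at h2
  have e1 : Real.exp y = Real.exp (y / 2) ^ 2 := by rw [← Real.exp_nat_mul]; congr 1; push_cast; ring
  have e2 : Real.exp (-y) = Real.exp (-(y / 2)) ^ 2 := by
    rw [← Real.exp_nat_mul]; congr 1; push_cast; ring
  have e3 : Real.exp (y / 2) * Real.exp (-(y / 2)) = 1 := by rw [← Real.exp_add]; simp
  rw [Real.sinh_eq] at h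
  nlinarith

lemma variance_bound {n : ℕ} (hn : 2 ≤ n) {p : ℝ} (h0 : 0 ≤ p) (h1 : p ≤ 1) :
    ∑ G : SimpleGraph (Fin n), wF p G * ((edgeCount G : ℝ) - p * (n.choose 2 : ℝ)) ^ 2 ≤
      4 * (p * (n.choose 2 : ℝ)) := by
  have hn' : (2 : ℝ) ≤ n := by exact_mod_cast hn
  set θ : ℝ := 1 / n with hθ
  have hθ0 : 0 < θ := by positivity
  have hθ1 : θ ≤ 1 := by rw [hθ, div_le_one (by positivity)]; linarith
  have a1 := mgf_bound (n := n) (θ := θ) h0 h1 (by rwa [abs_of_pos hθ0]) Finset.univ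
  have a2 := mgf_bound (n := n) (θ := -θ) h0 h1 (by rwa [abs_neg, abs_of_pos hθ0]) Finset.univ
  simp only [tauF_univ, touchF_univ, card_pairsF] at a1 a2
  set N : ℝ := (n.choose 2 : ℝ) with hN
  have hNn : N ≤ n ^ 2 := by
    rw [hN, Nat.cast_choose_two]; nlinarith
  have hN0 : 0 ≤ N := by positivity
  set u : ℝ := p * N * θ ^ 2 with hu
  have hu0 : 0 ≤ u := by positivity
  have hu1 : u ≤ 1 := by
    rw [hu, hθ, div_pow, one_pow, mul_one_div, div_le_one (by positivity)]
    nlinarith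
  have a3 : Real.exp u ≤ 1 + 2 * u := by
    have := (abs_le.1 (Real.abs_exp_sub_one_sub_id_le (x := u) (by rwa [abs_of_nonneg hu0]))).2
    nlinarith
  have a4 : θ ^ 2 * ∑ G : SimpleGraph (Fin n), wF p G * ((edgeCount G : ℝ) - p * N) ^ 2 ≤
      Real.exp u + Real.exp u - 2 := by
    calc _ ≤ ∑ G : SimpleGraph (Fin n), (wF p G * Real.exp (θ * (edgeCount G - p * N)) +
            wF p G * Real.exp (-θ * (edgeCount G - p * N)) - 2 * wF p G) := by
          rw [Finset.mul_sum]
          refine Finset.sum_le_sum fun G _ => ?_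
          have b1 := sq_le_exp (θ * (edgeCount G - p * N))
          have b2 := mul_le_mul_of_nonneg_left b1 (wF_nonneg h0 h1 G)
          rw [← neg_mul] at b2
          nlinarith
      _ ≤ _ := by
          rw [Finset.sum_sub_distrib, Finset.sum_add_distrib, ← Finset.mul_sum, wF_sum]
          rw [neg_sq] at a2
          linarith
  have a5 : θ ^ 2 * ∑ G : SimpleGraph (Fin n), wF p G * ((edgeCount G : ℝ) - p * N) ^ 2 ≤
      θ ^ 2 * (4 * (p * N)) := by nlinarith
  exact le_of_mul_le_mul_left a5 (by positivity)

/-- Deviation event complement. -/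
def Conc {n : ℕ} (p L : ℝ) (G : SimpleGraph (Fin n)) : Prop :=
  ∀ T : Finset (Fin n), |(tauF G T : ℝ) - p * (touchF T).card| ≤ T.card * L

lemma sum_pow_card (n : ℕ) (x : ℝ) : ∑ T : Finset (Fin n), x ^ T.card = (1 + x) ^ n := by
  have := Fintype.sum_pow_mul_eq_add_pow (Fin n) x 1
  simpa [add_comm] using this

open Classical in
lemma conc_prob {n : ℕ} (hn : 2 ≤ n) {p μ : ℝ} (h0 : 0 ≤ p) (h1 : p ≤ 1) (hpμ : p ≤ μ)
    (hμ : Real.log n / n ≤ μ) :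
    ∑ G : SimpleGraph (Fin n),
      wF p G * (if Conc p (6 * √(n * μ * Real.log n)) G then 0 else 1) ≤ 4 / (n : ℝ) ^ 4 := by
  have hn' : (2 : ℝ) ≤ n := by exact_mod_cast hn
  set l : ℝ := Real.log n with hl
  have hl0 : 0 < l := Real.log_pos (by linarith)
  have hnμ : l ≤ n * μ := by rw [div_le_iff₀ (by positivity)] at hμ; linarith
  have hnμ0 : 0 < n * μ := by linarith
  have hμ0 : 0 < μ := lt_of_lt_of_le (by positivity) hμ
  set R : ℝ := √(n * μ * l) with hR
  set θ : ℝ := √(l / (n * μ)) with hθ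
  have hθ0 : 0 ≤ θ := Real.sqrt_nonneg _
  have hθ1 : θ ≤ 1 := by
    rw [hθ]; exact Real.sqrt_le_one.2 ((div_le_one hnμ0).2 hnμ)
  have hθR : θ * R = l := by
    rw [hθ, hR, ← Real.sqrt_mul (by positivity)]
    rw [show l / (n * μ) * (n * μ * l) = l ^ 2 by field_simp]
    exact Real.sqrt_sq hl0.le
  have hθ2 : θ ^ 2 * (n * μ) = l := by
    rw [hθ, Real.sq_sqrt (by positivity)]; field_simp
  set x : ℝ := Real.exp (-(5 * l)) with hx
  have hxn : x = 1 / (n : ℝ) ^ 5 := by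
    rw [hx, Real.exp_neg, show (5 : ℝ) * l = ((5 : ℕ) : ℝ) * l by norm_num, Real.exp_nat_mul, hl,
      Real.exp_log (by linarith), one_div]
  -- single set bound
  have hone : ∀ T : Finset (Fin n), ∀ σ : ℝ, (σ = 1 ∨ σ = -1) →
      ∑ G : SimpleGraph (Fin n), wF p G *
        Real.exp (σ * θ * (tauF G T - p * (touchF T).card) - θ * (T.card * (6 * R))) ≤
        x ^ T.card := by
    intro T σ hσ
    have hσ2 : σ ^ 2 = 1 := by rcases hσ with h | h <;> rw [h] <;> norm_num
    have hσa : |σ * θ| ≤ 1 := by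
      rcases hσ with h | h <;> rw [h] <;> simp [abs_of_nonneg hθ0, hθ1]
    have b1 := mgf_bound (n := n) h0 h1 hσa T
    have b2 : ∀ G : SimpleGraph (Fin n), wF p G *
        Real.exp (σ * θ * (tauF G T - p * (touchF T).card) - θ * (T.card * (6 * R))) =
        wF p G * Real.exp (σ * θ * (tauF G T - p * (touchF T).card)) *
          Real.exp (- (θ * (T.card * (6 * R)))) := by
      intro G; rw [mul_assoc (wF p G), ← Real.exp_add]; rfl
    rw [Finset.sum_congr rfl (fun G _ => b2 G), ← Finset.sum_mul]
    calc _ ≤ Real.exp (p * (touchF T).card * (σ * θ) ^ 2) * Real.exp (- (θ * (T.card * (6 * R)))) := by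
          gcongr
      _ ≤ _ := by
          rw [hx, ← Real.exp_nat_mul, ← Real.exp_add, Real.exp_le_exp, mul_pow, hσ2]
          have c1 : ((touchF T).card : ℝ) ≤ T.card * n := by exact_mod_cast card_touchF_le T
          have c2 : p * (touchF T).card ≤ μ * (T.card * n) := by gcongr
          have c3 : p * (touchF T).card * θ ^ 2 ≤ μ * (T.card * n) * θ ^ 2 := by gcongr
          have c4 : μ * (T.card * n) * θ ^ 2 = T.card * l := by rw [← hθ2]; ring
          have c5 : θ * (T.card * (6 * R)) = 6 * T.card * l := by rw [← hθR]; ring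
          linarith
  -- pointwise bound
  have hpt : ∀ G : SimpleGraph (Fin n), (if Conc p (6 * R) G then (0 : ℝ) else 1) ≤
      ∑ T ∈ (Finset.univ : Finset (Finset (Fin n))).erase ∅,
        (Real.exp (1 * θ * (tauF G T - p * (touchF T).card) - θ * (T.card * (6 * R))) +
         Real.exp (-1 * θ * (tauF G T - p * (touchF T).card) - θ * (T.card * (6 * R)))) := by
    intro G
    split_ifs with h
    · positivity
    · simp only [Conc, not_forall, not_le] at h
      obtain ⟨T, hT⟩ := h
      have hTne : T ≠ ∅ := by
        rintro rfl
        have : touchF (∅ : Finset (Fin n)) = ∅ := by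
          simp [touchF]
        simp [tauF, this] at hT
      refine le_trans ?_ (Finset.single_le_sum (f := fun T : Finset (Fin n) =>
        (Real.exp (1 * θ * (tauF G T - p * (touchF T).card) - θ * (T.card * (6 * R))) +
         Real.exp (-1 * θ * (tauF G T - p * (touchF T).card) - θ * (T.card * (6 * R)))))
        (fun _ _ => by positivity) (Finset.mem_erase.2 ⟨hTne, Finset.mem_univ T⟩))
      have p1 := Real.exp_pos (1 * θ * (tauF G T - p * (touchF T).card) - θ * (T.card * (6 * R)))
      have p2 := Real.exp_pos (-1 * θ * (tauF G T - p * (touchF T).card) - θ * (T.card * (6 * R)))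
      rcases lt_abs.1 hT with h | h
      · have : (0:ℝ) ≤ 1 * θ * (tauF G T - p * (touchF T).card) - θ * (T.card * (6 * R)) := by
          nlinarith
        have := Real.one_le_exp this
        linarith
      · have : (0:ℝ) ≤ -1 * θ * (tauF G T - p * (touchF T).card) - θ * (T.card * (6 * R)) := by
          nlinarith
        have := Real.one_le_exp this
        linarith
  have hx0 : 0 ≤ x := (Real.exp_pos _).le
  have hnx : n * x = 1 / (n : ℝ) ^ 4 := by rw [hxn]; field_simp
  have hnx1 : n * x ≤ 1 := by
    rw [hnx, div_le_one (by positivity)]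
    exact one_le_pow₀ (by linarith)
  calc _ ≤ ∑ G : SimpleGraph (Fin n), wF p G *
        ∑ T ∈ (Finset.univ : Finset (Finset (Fin n))).erase ∅,
        (Real.exp (1 * θ * (tauF G T - p * (touchF T).card) - θ * (T.card * (6 * R))) +
         Real.exp (-1 * θ * (tauF G T - p * (touchF T).card) - θ * (T.card * (6 * R)))) :=
        Finset.sum_le_sum fun G _ => mul_le_mul_of_nonneg_left (hpt G) (wF_nonneg h0 h1 G)
    _ = ∑ T ∈ (Finset.univ : Finset (Finset (Fin n))).erase ∅,
        ((∑ G : SimpleGraph (Fin n), wF p G *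
          Real.exp (1 * θ * (tauF G T - p * (touchF T).card) - θ * (T.card * (6 * R)))) +
         (∑ G : SimpleGraph (Fin n), wF p G *
          Real.exp (-1 * θ * (tauF G T - p * (touchF T).card) - θ * (T.card * (6 * R))))) := by
        simp only [Finset.mul_sum]
        rw [Finset.sum_comm]
        simp only [mul_add, Finset.sum_add_distrib]
    _ ≤ ∑ T ∈ (Finset.univ : Finset (Finset (Fin n))).erase ∅, (x ^ T.card + x ^ T.card) :=
        Finset.sum_le_sum fun T _ => add_le_add (hone T 1 (Or.inl rfl)) (hone T (-1) (Or.inr rfl))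
    _ = 2 * ((1 + x) ^ n - 1) := by
        rw [← sum_pow_card, ← Finset.add_sum_erase _ _ (Finset.mem_univ (∅ : Finset (Fin n))),
          Finset.sum_add_distrib]
        simp only [Finset.card_empty, pow_zero]
        ring
    _ ≤ 2 * (Real.exp (n * x) - 1) := by
        rw [Real.exp_nat_mul]
        gcongr
        linarith [Real.add_one_le_exp x]
    _ ≤ 2 * (2 * (n * x)) := by
        have := (abs_le.1 (Real.abs_exp_sub_one_sub_id_le (x := n * x)
          (by rwa [abs_of_nonneg (by positivity)]))).2
        have : (0:ℝ) ≤ n * x := by positivity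
        nlinarith
    _ = _ := by rw [hnx]; ring

lemma choose_two_lower {n : ℕ} (hn : 2 ≤ n) : (n : ℝ) ^ 2 / 4 ≤ (n.choose 2 : ℝ) := by
  have hn' : (2 : ℝ) ≤ n := by exact_mod_cast hn
  rw [Nat.cast_choose_two]; nlinarith

lemma choose_two_upper (n : ℕ) : (n.choose 2 : ℝ) ≤ (n : ℝ) ^ 2 / 2 := by
  have hn' : (0 : ℝ) ≤ n := Nat.cast_nonneg n
  rw [Nat.cast_choose_two]; nlinarith

lemma typ_of_conc {n : ℕ} (hn : 2 ≤ n) {p R : ℝ} (hR : 0 ≤ R) {G : SimpleGraph (Fin n)}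
    (h : Conc p R G) : Typ (5 * R) G := by
  have hn' : (2 : ℝ) ≤ n := by exact_mod_cast hn
  have hN := choose_two_lower hn
  have hN0 : 0 < (n.choose 2 : ℝ) := lt_of_lt_of_le (by positivity) hN
  have hV := h Finset.univ
  rw [tauF_univ, touchF_univ, card_pairsF, Finset.card_univ, Fintype.card_fin] at hV
  intro T
  have hT := h T
  have hc : ((touchF T).card : ℝ) ≤ T.card * n := by exact_mod_cast card_touchF_le T
  set N : ℝ := (n.choose 2 : ℝ)
  set c : ℝ := ((touchF T).card : ℝ)
  have hc0 : 0 ≤ c := Nat.cast_nonneg _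
  have e1 : (tauF G T : ℝ) - (edgeCount G : ℝ) / N * c =
      ((tauF G T : ℝ) - p * c) - ((edgeCount G : ℝ) - p * N) / N * c := by
    field_simp; ring
  have e2 : |((edgeCount G : ℝ) - p * N) / N * c| ≤ T.card * (4 * R) := by
    rw [abs_mul, abs_div, abs_of_pos hN0, abs_of_nonneg hc0, div_mul_eq_mul_div, div_le_iff₀ hN0]
    calc _ ≤ (n * R) * (T.card * n) := by gcongr
      _ = T.card * (4 * R) * ((n : ℝ) ^ 2 / 4) := by ring
      _ ≤ _ := by gcongr
  rw [e1]
  calc _ ≤ _ := abs_sub _ _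
    _ ≤ T.card * R + T.card * (4 * R) := add_le_add hT e2
    _ = _ := by ring

lemma score_lower {n : ℕ} (hn : 2 ≤ n) {L : ℝ} (hL : 0 < L) {G : SimpleGraph (Fin n)}
    (h : Typ L G) (k : ℕ) :
    (n : ℝ) / 8 ≤ score L G k ∨ |(k : ℝ) - edgeCount G| / (4 * L) ≤ score L G k := by
  have hn' : (2 : ℝ) ≤ n := by exact_mod_cast hn
  have hN := choose_two_lower hn
  have hN0 : 0 < (n.choose 2 : ℝ) := lt_of_lt_of_le (by positivity) hN
  obtain ⟨H, T, hH, hT, hs⟩ := score_attained hL.le G k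
  have hpos : 0 ≤ |(edgeCount H : ℝ) - k| / L := by positivity
  by_cases hc : (n : ℝ) / 8 ≤ T.card
  · left; linarith
  · right
    push Not at hc
    have g1 := abs_le.1 (h T)
    have g2 := abs_le.1 (hH T)
    have g3 := agree_diff hT
    have hcard : ((touchF T).card : ℝ) ≤ T.card * n := by exact_mod_cast card_touchF_le T
    set N : ℝ := (n.choose 2 : ℝ)
    have hr : ((touchF T).card : ℝ) / N ≤ 1 / 2 := by
      rw [div_le_iff₀ hN0]; nlinarith
    have hr0 : 0 ≤ ((touchF T).card : ℝ) / N := by positivity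
    set r : ℝ := ((touchF T).card : ℝ) / N with hrdef
    have q1 : (edgeCount G : ℝ) / N * (touchF T).card = edgeCount G * r := by rw [hrdef]; ring
    have q2 : (edgeCount H : ℝ) / N * (touchF T).card = edgeCount H * r := by rw [hrdef]; ring
    rw [q1] at g1
    rw [q2] at g2
    have hd : |(edgeCount H : ℝ) - edgeCount G| ≤ 4 * (T.card * L) := by
      have a0 : |((edgeCount H : ℝ) - edgeCount G) * (1 - r)| ≤ 2 * (T.card * L) := by
        rw [abs_le]
        constructor <;> linarith [g1.1, g1.2, g2.1, g2.2]
      rw [abs_mul, abs_of_nonneg (show 0 ≤ 1 - r by linarith)] at a0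
      nlinarith [abs_nonneg ((edgeCount H : ℝ) - edgeCount G)]
    rw [hs, div_le_iff₀ (by positivity)]
    have e1 : ((T.card : ℝ) + |(edgeCount H : ℝ) - k| / L) * (4 * L) =
        4 * (T.card * L) + 4 * |(edgeCount H : ℝ) - k| := by field_simp
    rw [e1]
    have t1 : |(k : ℝ) - edgeCount G| ≤ |(k : ℝ) - edgeCount H| + |(edgeCount H : ℝ) - edgeCount G| :=
      abs_sub_le _ _ _
    rw [abs_sub_comm (k : ℝ) (edgeCount H : ℝ)] at t1
    linarith [abs_nonneg ((edgeCount H : ℝ) - k)]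

lemma score_upper {n : ℕ} {L : ℝ} {G : SimpleGraph (Fin n)} (h : Typ L G) (k : ℕ) :
    score L G k ≤ |(edgeCount G : ℝ) - k| / L := by
  have := score_le (G := G) (T := ∅) h (fun _ _ _ _ => Iff.rfl) k
  simpa using this

lemma geom_le_aux {r : ℝ} (h0 : 0 ≤ r) (h1 : r < 1) (m : ℕ) :
    ∑ i ∈ Finset.range m, r ^ i ≤ 1 / (1 - r) := by
  have h := geom_sum_mul_neg r m
  rw [le_div_iff₀ (by linarith), h]
  have : 0 ≤ r ^ m := by positivity
  linarith

lemma sum_exp_abs {b : ℝ} (hb : 0 < b) (hb1 : b ≤ 1) (e m : ℕ) :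
    ∑ k ∈ Finset.range m, Real.exp (-b * |(k : ℝ) - e|) ≤ 4 / b := by
  set r := Real.exp (-b) with hr
  have hr0 : 0 ≤ r := (Real.exp_pos _).le
  have hr1 : r < 1 := by rw [hr, Real.exp_lt_one_iff]; linarith
  have hrb : b / 2 ≤ 1 - r := by
    have h := Real.add_one_le_exp b
    have e1 : r * Real.exp b = 1 := by rw [hr, ← Real.exp_add]; simp
    nlinarith
  have hg : 1 / (1 - r) ≤ 2 / b := by
    rw [div_le_div_iff₀ (by linarith) hb]; linarith
  calc _ ≤ ∑ k ∈ Finset.range (e + m), Real.exp (-b * |(k : ℝ) - e|) :=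
        Finset.sum_le_sum_of_subset_of_nonneg (Finset.range_mono (by omega))
          (fun _ _ _ => (Real.exp_pos _).le)
    _ = ∑ k ∈ Finset.range e, Real.exp (-b * |(k : ℝ) - e|) +
        ∑ k ∈ Finset.range m, Real.exp (-b * |((e + k : ℕ) : ℝ) - e|) :=
        Finset.sum_range_add _ _ _
    _ ≤ ∑ k ∈ Finset.range e, r ^ k + ∑ k ∈ Finset.range m, r ^ k := by
        refine add_le_add ?_ (Finset.sum_le_sum fun k _ => ?_)
        · rw [← Finset.sum_range_reflect]
          refine Finset.sum_le_sum fun k hk => ?_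
          have hk' : k < e := Finset.mem_range.1 hk
          rw [hr, ← Real.exp_nat_mul, Real.exp_le_exp]
          have : (((e - 1 - k : ℕ) : ℝ)) = e - 1 - k := by
            rw [Nat.sub_sub, Nat.cast_sub (by omega)]; push_cast; ring
          rw [this]
          have : |(e : ℝ) - 1 - k - e| = 1 + k := by
            rw [show (e : ℝ) - 1 - k - e = -(1 + k) by ring, abs_neg, abs_of_nonneg (by positivity)]
          rw [this]
          nlinarith
        · rw [hr, ← Real.exp_nat_mul, Real.exp_le_exp]
          push_cast
          rw [add_sub_cancel_left, abs_of_nonneg (by positivity)]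
          linarith
    _ ≤ 2 / b + 2 / b :=
        add_le_add ((geom_le_aux hr0 hr1 _).trans hg) ((geom_le_aux hr0 hr1 _).trans hg)
    _ = _ := by ring

lemma sum_sq_exp_abs {a : ℝ} (ha : 0 < a) (ha1 : a ≤ 1) (e m : ℕ) :
    ∑ k ∈ Finset.range m, ((k : ℝ) - e) ^ 2 * Real.exp (-a * |(k : ℝ) - e|) ≤ 64 / a ^ 3 := by
  have h := sum_exp_abs (b := a / 2) (by linarith) (by linarith) e m
  calc _ ≤ ∑ k ∈ Finset.range m, 8 / a ^ 2 * Real.exp (-(a / 2) * |(k : ℝ) - e|) := by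
        refine Finset.sum_le_sum fun k _ => ?_
        set j : ℝ := |(k : ℝ) - e| with hj
        have hj0 : 0 ≤ j := abs_nonneg _
        rw [← sq_abs, ← hj]
        have h1 := Real.quadratic_le_exp_of_nonneg (x := a / 2 * j) (by positivity)
        have h2 : j ^ 2 ≤ 8 / a ^ 2 * Real.exp (a / 2 * j) := by
          rw [div_mul_eq_mul_div, le_div_iff₀ (by positivity)]
          have : 0 ≤ a / 2 * j := by positivity
          nlinarith
        calc _ ≤ 8 / a ^ 2 * Real.exp (a / 2 * j) * Real.exp (-a * j) := by gcongr
          _ = _ := by rw [mul_assoc, ← Real.exp_add]; congr 2; ring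
    _ ≤ 8 / a ^ 2 * (4 / (a / 2)) := by
        rw [← Finset.mul_sum]; gcongr
    _ = _ := by field_simp; norm_num

lemma second_moment {n : ℕ} (hn : 2 ≤ n) {ε L : ℝ} (hε : 0 < ε) (hε1 : ε < 1) (hL : 1 ≤ L)
    (hB : L / ε ≤ (n : ℝ) ^ 2) (hlog : 96 * Real.log n ≤ ε * n) {G : SimpleGraph (Fin n)}
    (h : Typ L G) :
    ∑ k ∈ Finset.range (2 * n ^ 2 + 1), Real.exp (-(ε / 2) * score L G k) *
      ((k : ℝ) - edgeCount G) ^ 2 ≤ 65560 * (L / ε) ^ 2 * ZF ε L (2 * n ^ 2) G := by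
  have hn' : (2 : ℝ) ≤ n := by exact_mod_cast hn
  have hL0 : 0 < L := by linarith
  set B : ℝ := L / ε with hBdef
  have hB1 : 1 ≤ B := by rw [hBdef, le_div_iff₀ hε]; linarith
  set e : ℕ := edgeCount G with he
  have heN : (e : ℝ) ≤ (n : ℝ) ^ 2 / 2 :=
    le_trans (by exact_mod_cast edgeCount_le G) (choose_two_upper n)
  set M : ℕ := 2 * n ^ 2 with hM
  -- lower bound on Z
  have hZ : B / 2 ≤ ZF ε L M G := by
    set q : ℕ := ⌊B⌋₊ with hq
    have hqB : (q : ℝ) ≤ B := Nat.floor_le (by linarith)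
    have hqB' : B < q + 1 := Nat.lt_floor_add_one B
    have hsub : (Finset.range (q + 1)).image (fun j => e + j) ⊆ Finset.range (M + 1) := by
      intro x hx
      obtain ⟨j, hj, rfl⟩ := Finset.mem_image.1 hx
      have hj' : j ≤ q := Nat.lt_succ_iff.1 (Finset.mem_range.1 hj)
      rw [Finset.mem_range, Nat.lt_succ_iff]
      have : ((e + j : ℕ) : ℝ) ≤ (M : ℝ) := by
        have : (j : ℝ) ≤ q := by exact_mod_cast hj'
        rw [hM]; push_cast
        nlinarith
      exact_mod_cast this
    have hex : (1 : ℝ) / 2 ≤ Real.exp (-(1 / 2)) := by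
      have := Real.add_one_le_exp (-(1 / 2) : ℝ); linarith
    calc B / 2 ≤ ∑ _j ∈ Finset.range (q + 1), (1 : ℝ) / 2 := by
          simp; linarith
      _ ≤ ∑ j ∈ Finset.range (q + 1), Real.exp (-(ε / 2) * score L G (e + j)) := by
          refine Finset.sum_le_sum fun j hj => hex.trans ?_
          rw [Real.exp_le_exp]
          have hj' : (j : ℝ) ≤ q := by
            exact_mod_cast Nat.lt_succ_iff.1 (Finset.mem_range.1 hj)
          have hu := score_upper h (e + j)
          rw [← he] at hu
          push_cast at hu
          rw [sub_add_cancel_left, abs_neg, abs_of_nonneg (Nat.cast_nonneg j)] at hu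
          have : (j : ℝ) / L ≤ 1 / ε := by
            rw [div_le_div_iff₀ hL0 hε]
            have : (j : ℝ) ≤ L / ε := by linarith
            rw [le_div_iff₀ hε] at this
            linarith
          have h3 : ε * score L G (e + j) ≤ 1 := by
            calc _ ≤ ε * (1 / ε) := by gcongr; linarith
              _ = 1 := by field_simp
          linarith
      _ = ∑ k ∈ (Finset.range (q + 1)).image (fun j => e + j),
            Real.exp (-(ε / 2) * score L G k) := by
          rw [Finset.sum_image]
          intro x _ y _ hxy
          simpa using hxy
      _ ≤ _ := Finset.sum_le_sum_of_subset_of_nonneg hsub (fun _ _ _ => (Real.exp_pos _).le)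
  -- upper bound
  set a : ℝ := ε / (8 * L) with ha
  have ha0 : 0 < a := by positivity
  have ha1 : a ≤ 1 := by rw [ha, div_le_one (by positivity)]; linarith
  have haB : 64 / a ^ 3 = 32768 * B ^ 3 := by
    rw [ha, hBdef]; field_simp; norm_num
  have hfl : Real.exp (-(ε * n / 16)) ≤ 1 / (n : ℝ) ^ 6 := by
    have : (1 : ℝ) / (n : ℝ) ^ 6 = Real.exp (-(6 * Real.log n)) := by
      rw [Real.exp_neg, show (6 : ℝ) * Real.log n = ((6 : ℕ) : ℝ) * Real.log n by norm_num,
        Real.exp_nat_mul, Real.exp_log (by linarith), one_div]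
    rw [this, Real.exp_le_exp]
    linarith
  have hterm : ∀ k ∈ Finset.range (M + 1), Real.exp (-(ε / 2) * score L G k) * ((k : ℝ) - e) ^ 2 ≤
      ((k : ℝ) - e) ^ 2 * Real.exp (-a * |(k : ℝ) - e|) + 4 / (n : ℝ) ^ 2 := by
    intro k hk
    have hk' : (k : ℝ) ≤ 2 * (n : ℝ) ^ 2 := by
      have := Nat.lt_succ_iff.1 (Finset.mem_range.1 hk)
      rw [hM] at this
      exact_mod_cast this
    have hk0 : (0 : ℝ) ≤ k := Nat.cast_nonneg k
    have he0 : (0 : ℝ) ≤ e := Nat.cast_nonneg e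
    rcases score_lower hn hL0 h k with hs | hs
    · have h1 : Real.exp (-(ε / 2) * score L G k) ≤ 1 / (n : ℝ) ^ 6 := by
        refine le_trans (Real.exp_le_exp.2 ?_) hfl
        nlinarith
      have h2 : ((k : ℝ) - e) ^ 2 ≤ (2 * (n : ℝ) ^ 2) ^ 2 := by
        apply sq_le_sq'
        · nlinarith
        · linarith
      have h3 : Real.exp (-(ε / 2) * score L G k) * ((k : ℝ) - e) ^ 2 ≤
          1 / (n : ℝ) ^ 6 * (2 * (n : ℝ) ^ 2) ^ 2 := by gcongr
      have h4 : 1 / (n : ℝ) ^ 6 * (2 * (n : ℝ) ^ 2) ^ 2 = 4 / (n : ℝ) ^ 2 := by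
        field_simp; norm_num
      have h5 : 0 ≤ ((k : ℝ) - e) ^ 2 * Real.exp (-a * |(k : ℝ) - e|) := by positivity
      linarith
    · have h1 : Real.exp (-(ε / 2) * score L G k) ≤ Real.exp (-a * |(k : ℝ) - e|) := by
        rw [Real.exp_le_exp]
        have : a * |(k : ℝ) - e| = ε / 2 * (|(k : ℝ) - e| / (4 * L)) := by
          rw [ha]; field_simp; ring
        have h2 : ε / 2 * (|(k : ℝ) - e| / (4 * L)) ≤ ε / 2 * score L G k := by gcongr
        linarith
      have h2 : Real.exp (-(ε / 2) * score L G k) * ((k : ℝ) - e) ^ 2 ≤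
        Real.exp (-a * |(k : ℝ) - e|) * ((k : ℝ) - e) ^ 2 := by gcongr
      have h3 : 0 ≤ 4 / (n : ℝ) ^ 2 := by positivity
      linarith
  calc _ ≤ ∑ k ∈ Finset.range (M + 1),
        (((k : ℝ) - e) ^ 2 * Real.exp (-a * |(k : ℝ) - e|) + 4 / (n : ℝ) ^ 2) :=
        Finset.sum_le_sum hterm
    _ ≤ 32768 * B ^ 3 + 12 := by
        rw [Finset.sum_add_distrib]
        refine add_le_add ((sum_sq_exp_abs ha0 ha1 e _).trans haB.le) ?_
        rw [Finset.sum_const, Finset.card_range, nsmul_eq_mul, mul_div_assoc',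
          div_le_iff₀ (by positivity), hM]
        push_cast
        nlinarith
    _ ≤ 65560 * B ^ 2 * (B / 2) := by
        have : 1 ≤ B ^ 3 := one_le_pow₀ hB1
        nlinarith
    _ ≤ _ := by gcongr

set_option maxHeartbeats 1000000 in
lemma final_bound {n : ℕ} (hn : 2 ≤ n) {ε ρ p : ℝ} (hε : 0 < ε) (hε1 : ε < 1)
    (hρ1 : ρ < 1) (hp0 : 0 ≤ p) (hp : p ≤ ρ) (hlog : 96 * Real.log n ≤ ε * n) :
    ∫ G, (∫ x, (x - p) ^ 2 ∂(mech ε (30 * √(n * max ρ (Real.log n / n) * Real.log n))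
        (2 * n ^ 2) G)) ∂(erMeasure n p)
      ≤ 2000000000 * (ρ / (n : ℝ) ^ 2
              + max ρ (Real.log n / n) * Real.log n / ((n : ℝ) ^ 3 * ε ^ 2)) := by
  classical
  have hn' : (2 : ℝ) ≤ n := by exact_mod_cast hn
  have hp1 : p ≤ 1 := by linarith
  have hl2 : 1 / 2 ≤ Real.log n := by
    have h1 := Real.log_two_gt_d9
    have h2 := Real.log_le_log (by norm_num) hn'
    linarith
  have hln : Real.log n ≤ n := (Real.log_le_sub_one_of_pos (by linarith)).trans (by linarith)
  have hvar := variance_bound hn hp0 hp1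
  have hconc := conc_prob hn (μ := max ρ (Real.log n / n)) hp0 hp1 (hp.trans (le_max_left _ _))
    (le_max_right _ _)
  set l : ℝ := Real.log n with hl
  set μ : ℝ := max ρ (l / n) with hμ
  have hμl : l / n ≤ μ := le_max_right _ _
  have hμ0 : 0 < μ := lt_of_lt_of_le (by positivity) hμl
  have hμ1 : μ ≤ 1 := max_le hρ1.le (by rw [div_le_one (by positivity)]; exact hln)
  have hnμ : l ≤ n * μ := by rw [div_le_iff₀ (by positivity)] at hμl; linarith
  set R : ℝ := √(n * μ * l) with hR
  have hR0 : 0 ≤ R := Real.sqrt_nonneg _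
  have hR2 : R ^ 2 = n * μ * l := Real.sq_sqrt (by positivity)
  have hRl : l ≤ R := Real.le_sqrt_of_sq_le (by nlinarith)
  have hRn : R ≤ n := by
    apply Real.sqrt_le_iff.2
    refine ⟨by linarith, ?_⟩
    have : (n : ℝ) * μ ≤ n := by nlinarith
    nlinarith
  set L : ℝ := 30 * R with hL
  have hL1 : 1 ≤ L := by linarith
  have hB : L / ε ≤ (n : ℝ) ^ 2 := by
    rw [div_le_iff₀ hε]
    nlinarith
  have hN := choose_two_lower hn
  have hN2 := choose_two_upper n
  have hN0 : 0 < (n.choose 2 : ℝ) := lt_of_lt_of_le (by positivity) hN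
  set N : ℝ := (n.choose 2 : ℝ) with hNdef
  rw [er_integral hp0 hp1]
  have hpt : ∀ G : SimpleGraph (Fin n), ∫ x, (x - p) ^ 2 ∂(mech ε L (2 * n ^ 2) G) ≤
      2 / N ^ 2 * ((edgeCount G : ℝ) - p * N) ^ 2 + 2 / N ^ 2 * (65560 * (L / ε) ^ 2) +
      64 * (if Conc p (6 * R) G then 0 else 1) := by
    intro G
    have hZ := ZF_pos ε L (2 * n ^ 2) G
    rw [mech_integral, div_le_iff₀ hZ, ← hNdef]
    split_ifs with hG
    · have hT : Typ L G := by
        have := typ_of_conc hn (by positivity) hG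
        rwa [show 5 * (6 * R) = L by rw [hL]; ring] at this
      have hs := second_moment hn hε hε1 hL1 hB hlog hT
      calc _ ≤ ∑ k ∈ Finset.range (2 * n ^ 2 + 1),
            (2 / N ^ 2 * ((edgeCount G : ℝ) - p * N) ^ 2 * Real.exp (-(ε / 2) * score L G k) +
            2 / N ^ 2 * (Real.exp (-(ε / 2) * score L G k) * ((k : ℝ) - edgeCount G) ^ 2)) := by
            refine Finset.sum_le_sum fun k _ => ?_
            have e1 : ((k : ℝ) / N - p) ^ 2 ≤ 2 / N ^ 2 * ((edgeCount G : ℝ) - p * N) ^ 2 +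
                2 / N ^ 2 * ((k : ℝ) - edgeCount G) ^ 2 := by
              have : (k : ℝ) / N - p = ((k : ℝ) - p * N) / N := by field_simp
              rw [this, div_pow, div_le_iff₀ (by positivity)]
              have : (2 / N ^ 2 * ((edgeCount G : ℝ) - p * N) ^ 2 +
                2 / N ^ 2 * ((k : ℝ) - edgeCount G) ^ 2) * N ^ 2 =
                2 * ((edgeCount G : ℝ) - p * N) ^ 2 + 2 * ((k : ℝ) - edgeCount G) ^ 2 := by
                field_simp
              rw [this]
              nlinarith [sq_nonneg (((edgeCount G : ℝ) - p * N) - ((k : ℝ) - edgeCount G))]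
            have := mul_le_mul_of_nonneg_left e1 (Real.exp_pos (-(ε / 2) * score L G k)).le
            linarith
        _ = 2 / N ^ 2 * ((edgeCount G : ℝ) - p * N) ^ 2 * ZF ε L (2 * n ^ 2) G +
            2 / N ^ 2 * ∑ k ∈ Finset.range (2 * n ^ 2 + 1),
              (Real.exp (-(ε / 2) * score L G k) * ((k : ℝ) - edgeCount G) ^ 2) := by
            rw [Finset.sum_add_distrib, ← Finset.mul_sum, ← Finset.mul_sum]; rfl
        _ ≤ 2 / N ^ 2 * ((edgeCount G : ℝ) - p * N) ^ 2 * ZF ε L (2 * n ^ 2) G +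
            2 / N ^ 2 * (65560 * (L / ε) ^ 2 * ZF ε L (2 * n ^ 2) G) := by gcongr
        _ = _ := by ring
    · have hb : ∑ k ∈ Finset.range (2 * n ^ 2 + 1),
          Real.exp (-(ε / 2) * score L G k) * ((k : ℝ) / N - p) ^ 2 ≤
          64 * ZF ε L (2 * n ^ 2) G := by
        rw [ZF, Finset.mul_sum]
        refine Finset.sum_le_sum fun k hk => ?_
        have hk' : (k : ℝ) ≤ 2 * (n : ℝ) ^ 2 := by
          exact_mod_cast Nat.lt_succ_iff.1 (Finset.mem_range.1 hk)
        have h1 : (k : ℝ) / N ≤ 8 := by rw [div_le_iff₀ hN0]; linarith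
        have h2 : 0 ≤ (k : ℝ) / N := by positivity
        have h3 : ((k : ℝ) / N - p) ^ 2 ≤ 64 := by nlinarith
        have := mul_le_mul_of_nonneg_left h3 (Real.exp_pos (-(ε / 2) * score L G k)).le
        linarith
      refine hb.trans ?_
      apply mul_le_mul_of_nonneg_right _ hZ.le
      have : 0 ≤ 2 / N ^ 2 * ((edgeCount G : ℝ) - p * N) ^ 2 + 2 / N ^ 2 * (65560 * (L / ε) ^ 2) := by
        positivity
      linarith
  have hsum : ∑ G : SimpleGraph (Fin n), wF p G * ∫ x, (x - p) ^ 2 ∂(mech ε L (2 * n ^ 2) G) ≤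
      2 / N ^ 2 * (4 * (p * N)) + 2 / N ^ 2 * (65560 * (L / ε) ^ 2) + 64 * (4 / (n : ℝ) ^ 4) := by
    calc _ ≤ ∑ G : SimpleGraph (Fin n),
          (2 / N ^ 2 * (wF p G * ((edgeCount G : ℝ) - p * N) ^ 2) +
          2 / N ^ 2 * (65560 * (L / ε) ^ 2) * wF p G +
          64 * (wF p G * (if Conc p (6 * R) G then 0 else 1))) := by
          refine Finset.sum_le_sum fun G _ => ?_
          have := mul_le_mul_of_nonneg_left (hpt G) (wF_nonneg hp0 hp1 G)
          linarith
      _ ≤ _ := by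
          rw [Finset.sum_add_distrib, Finset.sum_add_distrib, ← Finset.mul_sum, ← Finset.mul_sum,
            ← Finset.mul_sum, wF_sum, mul_one]
          gcongr
  refine hsum.trans ?_
  have t1 : 2 / N ^ 2 * (4 * (p * N)) ≤ 32 * (ρ / (n : ℝ) ^ 2) := by
    have : 2 / N ^ 2 * (4 * (p * N)) = 8 * p / N := by field_simp; ring
    rw [this, mul_div_assoc', div_le_div_iff₀ hN0 (by positivity)]
    calc 8 * p * (n : ℝ) ^ 2 ≤ 8 * ρ * (4 * N) := by gcongr <;> linarith
      _ = _ := by ring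
  have t2 : 2 / N ^ 2 * (65560 * (L / ε) ^ 2) ≤
      1888128000 * (μ * l / ((n : ℝ) ^ 3 * ε ^ 2)) := by
    have a1 : 2 / N ^ 2 ≤ 2 / ((n : ℝ) ^ 2 / 4) ^ 2 := by gcongr
    calc _ ≤ 2 / ((n : ℝ) ^ 2 / 4) ^ 2 * (65560 * (L / ε) ^ 2) := by gcongr
      _ = _ := by
        rw [hL, div_pow (30 * R), mul_pow 30 R, hR2]
        field_simp
        norm_num
  have t3 : 64 * (4 / (n : ℝ) ^ 4) ≤ 1024 * (μ * l / ((n : ℝ) ^ 3 * ε ^ 2)) := by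
    have hε2 : ε ^ 2 ≤ 1 := by nlinarith
    calc 64 * (4 / (n : ℝ) ^ 4) ≤ 1024 * ((l / n) * l / ((n : ℝ) ^ 3 * 1)) := by
          rw [show (l / n) * l / ((n : ℝ) ^ 3 * 1) = l ^ 2 / (n : ℝ) ^ 4 by field_simp,
            mul_div_assoc', mul_div_assoc']
          apply div_le_div_of_nonneg_right _ (by positivity)
          nlinarith
      _ ≤ _ := by gcongr
  have t4 : 0 ≤ ρ / (n : ℝ) ^ 2 := by
    have : 0 ≤ ρ := hp0.trans hp
    positivity
  have t5 : 0 ≤ μ * l / ((n : ℝ) ^ 3 * ε ^ 2) := by positivity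
  linarith

/-- For sequences `ε_n, ρ_n ∈ (0,1)` with `ε_n·n/log n → ∞`, there are a constant `K`, an
index `n₀`, and `ε_n`-node differentially private algorithms `A_n` (mapping graphs on `n`
vertices to probability measures on `ℝ`) such that for all `n ≥ n₀` and all `p ∈ [0, ρ_n]`,
`E_{G ∼ G_{n,p}, x ∼ A_n(G)}[(x − p)²] ≤ K·(ρ_n/n² + max{ρ_n,(log n)/n}·(log n)/(n³·ε_n²))`. -/
theorem er_private_density_estimation (ε ρ : ℕ → ℝ)
    (hε : ∀ n, ε n ∈ Set.Ioo (0 : ℝ) 1) (hρ : ∀ n, ρ n ∈ Set.Ioo (0 : ℝ) 1)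
    (hlim : Filter.Tendsto (fun n : ℕ => ε n * (n : ℝ) / Real.log n) Filter.atTop Filter.atTop) :
    ∃ K : ℝ, ∃ n₀ : ℕ, ∃ A : (n : ℕ) → SimpleGraph (Fin n) → Measure ℝ,
      (∀ n : ℕ, ∀ G, IsProbabilityMeasure (A n G)) ∧
      (∀ n : ℕ, ∀ G G' : SimpleGraph (Fin n), ∀ S : Set ℝ, MeasurableSet S →
        A n G S ≤ ENNReal.ofReal (Real.exp (ε n * (nodeDist G G' : ℝ))) * A n G' S) ∧
      (∀ n : ℕ, n₀ ≤ n → ∀ p ∈ Set.Icc (0 : ℝ) (ρ n),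
        ∫ G, (∫ x, (x - p) ^ 2 ∂(A n G)) ∂(erMeasure n p)
          ≤ K * (ρ n / (n : ℝ) ^ 2
              + max (ρ n) (Real.log n / n) * Real.log n / ((n : ℝ) ^ 3 * (ε n) ^ 2))) := by
  have hev := hlim.eventually_ge_atTop 96
  obtain ⟨n₁, hn₁⟩ := Filter.eventually_atTop.1 hev
  refine ⟨2000000000, max 2 n₁,
    fun n G => mech (ε n) (30 * √(n * max (ρ n) (Real.log n / n) * Real.log n)) (2 * n ^ 2) G,
    fun n G => mech_prob _ _ _ _, ?_, ?_⟩
  · intro n G G' S _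
    exact mech_private (hε n).1.le (by positivity) _ G G' S
  · intro n hn p hp
    have hn2 : 2 ≤ n := (le_max_left _ _).trans hn
    have hn' : (2 : ℝ) ≤ n := by exact_mod_cast hn2
    have hl : 0 < Real.log n := Real.log_pos (by linarith)
    have h96 := hn₁ n ((le_max_right _ _).trans hn)
    rw [le_div_iff₀ hl] at h96
    exact final_bound hn2 (hε n).1 (hε n).2 (hρ n).2 hp.1 hp.2 h96

end
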